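/- Let G be a group, H a normal subgroup of G, and α = (α^{(t)})_{t ∈ ℕ} a sequence of finitely supported functions α^{(t)} : G → ℂ. Let ψ be the fundamental solution of the automaton on G/H determined by (r_H α^{(t)})_{t ∈ ℕ}, where (r_H α^{(t)})([g]) = ∑_{h ∈ H} α^{(t)}(gh). Then the pullback (t ↦ ψ^{(t)} ∘ π_H) equals the fundamental H-periodic solution φ^H of the automaton on G determined by α, i.e. the unique solution with (φ^H)^{(0)}(h) = 1 for all h ∈ H and (φ^H)^{(0)}(g) = 0 for all g ∉ H. -/

import Mathlib

open scoped Classical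

open scoped BigOperators

/-- Convolution on `G` of a finitely supported function with an arbitrary function:
`(a ⋆ f) g = ∑_{h ∈ G} a h * f (h⁻¹ * g)` (a finite sum over the support of `a`). -/
noncomputable def conv {G : Type*} [Group G] (a : G →₀ ℂ) (f : G → ℂ) : G → ℂ :=
  fun g => ∑ h ∈ a.support, a h * f (h⁻¹ * g)

/-- `s` is a solution of the linear cellular automaton determined by `α`. -/
def IsSol {G : Type*} [Group G] (α : ℕ → (G →₀ ℂ)) (s : ℕ → G → ℂ) : Prop :=
  ∀ t, s (t + 1) = conv (α t) (s t)

/-- Convolution on a group `Q` of an arbitrary (in practice finitely supported)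
kernel `b` with a function `f`. -/
noncomputable def convQ {Q : Type*} [Group Q] (b : Q → ℂ) (f : Q → ℂ) : Q → ℂ :=
  fun x => ∑ᶠ y : Q, b y * f (y⁻¹ * x)

/-- `(r_H a)([g]) = ∑_{h ∈ H} a (g * h)`. -/
noncomputable def rH {G : Type*} [Group G] (H : Subgroup G) [H.Normal] (a : G →₀ ℂ) :
    G ⧸ H → ℂ :=
  fun x => ∑ᶠ h : H, a (Quotient.out x * (h : G))

/-- `s` is a solution of the quotient automaton on `G ⧸ H` determined by `r_H ∘ α`. -/
def IsSolQ {G : Type*} [Group G] (H : Subgroup G) [H.Normal] (α : ℕ → (G →₀ ℂ))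
    (s : ℕ → G ⧸ H → ℂ) : Prop :=
  ∀ t, s (t + 1) = convQ (rH H (α t)) (s t)

/-- `s` is an `H`-periodic sequence of states. -/
def IsPeriodic {G : Type*} [Group G] (H : Subgroup G) (s : ℕ → G → ℂ) : Prop :=
  ∀ (t : ℕ) (g h : G), h ∈ H → s t (g * h) = s t g

/-- The pullback of a sequence of states on `G ⧸ H` to a sequence of states on `G`. -/
def pullback {G : Type*} [Group G] (H : Subgroup G) [H.Normal]
    (s : ℕ → G ⧸ H → ℂ) : ℕ → G → ℂ :=
  fun t g => s t (QuotientGroup.mk g)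


theorem rH_eq_sum {G : Type*} [Group G] (H : Subgroup G) [H.Normal] (a : G →₀ ℂ)
    (x : G ⧸ H) :
    rH H a x = ∑ g ∈ a.support with QuotientGroup.mk g = x, a g := by
  have hinj : Function.Injective fun h : H => Quotient.out x * (h : G) := fun h k hk =>
    Subtype.ext (mul_left_cancel hk)
  unfold rH
  rw [← finsum_mem_range (f := fun g => a g) hinj]
  apply finsum_mem_eq_sum_of_inter_support_eq
  ext g
  simp only [Set.mem_inter_iff, Set.mem_range, Function.mem_support, Finset.coe_filter,
    Finsupp.mem_support_iff, Set.mem_ofPred_eq]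
  have hmem : (∃ h : H, Quotient.out x * (h : G) = g) ↔ (QuotientGroup.mk g : G ⧸ H) = x := by
    have hx : (QuotientGroup.mk (Quotient.out x) : G ⧸ H) = x := QuotientGroup.out_eq' x
    constructor
    · rintro ⟨h, rfl⟩
      rw [QuotientGroup.mk_mul_of_mem _ h.2, hx]
    · intro hg
      exact ⟨⟨(Quotient.out x)⁻¹ * g, QuotientGroup.eq.1 (hx.trans hg.symm)⟩,
        mul_inv_cancel_left _ _⟩
  rw [hmem]
  tauto

theorem convQ_rH_mk {G : Type*} [Group G] (H : Subgroup G) [H.Normal] (a : G →₀ ℂ)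
    (f : G ⧸ H → ℂ) (g : G) :
    convQ (rH H a) f (QuotientGroup.mk g) = conv a (fun k => f (QuotientGroup.mk k)) g := by
  unfold convQ conv
  rw [finsum_eq_sum_of_support_subset
    (s := a.support.image (QuotientGroup.mk : G → G ⧸ H)),
    ← Finset.sum_fiberwise_of_maps_to (g := (QuotientGroup.mk : G → G ⧸ H))
      (fun k hk => Finset.mem_image_of_mem _ hk)]
  · refine Finset.sum_congr rfl fun y _ => ?_
    rw [rH_eq_sum, Finset.sum_mul]
    refine Finset.sum_congr rfl fun k hk => ?_
    simp only [← (Finset.mem_filter.1 hk).2, QuotientGroup.mk_mul, QuotientGroup.mk_inv]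
  · intro y hy
    have hne := left_ne_zero_of_mul hy
    rw [rH_eq_sum] at hne
    obtain ⟨k, hk, -⟩ := Finset.exists_ne_zero_of_sum_ne_zero hne
    obtain ⟨hka, rfl⟩ := Finset.mem_filter.1 hk
    exact Finset.mem_coe.2 (Finset.mem_image_of_mem _ hka)

/-- the pullback of the fundamental solution of the quotient automaton on
`G ⧸ H` is the fundamental `H`-periodic solution of the automaton on `G`. -/
theorem stmt_2 {G : Type*} [Group G] (H : Subgroup G) [H.Normal] (α : ℕ → (G →₀ ℂ))
    (ψ : ℕ → G ⧸ H → ℂ) (hψ : IsSolQ H α ψ)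
    (hψ0 : ψ 0 = fun x => if x = 1 then 1 else 0)
    (φH : ℕ → G → ℂ) (hφH : IsSol α φH)
    (hφH0 : φH 0 = fun g => if g ∈ H then 1 else 0) :
    pullback H ψ = φH := by
  funext t
  induction t with
  | zero =>
    funext g
    simp [pullback, hψ0, hφH0, QuotientGroup.eq_one_iff]
  | succ t ih =>
    funext g
    rw [hφH t, ← ih]
    unfold pullback
    rw [hψ t, convQ_rH_mk]
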